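/- arXiv:2406.05405 — 2 statements merged into one kernel-verified Lean document; each statement's English description precedes it below -/
import Mathlib

section
/- Let n ≥ 1, let w_1,…,w_n ≥ 0 and real scores S_1 ≤ S_2 ≤ … ≤ S_n be given, set S_{n+1} = +∞, fix γ ∈ [0,1] and a subset I ⊆ {1,…,n} with ∑_{k∈I} w_k > 0. For ω ≥ 0 define p_i(ω) = w_i/(∑_{k∈I} w_k + ω) for i ∈ I, p_{n+1}(ω) = ω/(∑_{k∈I} w_k + ω), and Q(ω) = S_{m(ω)} where m(ω) = min{ i ∈ I ∪ {n+1} : ∑_{k ∈ (I ∪ {n+1}) ∩ {1,…,i}} p_k(ω) ≥ γ }. Then Q is non-decreasing in the test weight: if ω₁ ≥ ω₂ ≥ 0 then Q(ω₁) ≥ Q(ω₂). -/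
/-
STATEMENT 5 (Lemma on weighted quantiles): the weighted quantile
`Q(ω) = S_{m(ω)}`, where `m(ω)` is the smallest feasible index, is a
non-decreasing function of the test weight `ω`.

The scores `S_1 ≤ … ≤ S_n` are real and `S_{n+1} = +∞`; since `S` is
monotone, `S_{m(ω)}` coincides with the infimum of the `S`-values over the
feasible indices, which is how `Q` is written below.
-/

open Finset
open scoped Classical

theorem weighted_quantile_monotone_in_test_weight
    (n : ℕ) (hn : 1 ≤ n)
    (w : Fin (n + 1) → ℝ) (hw : ∀ i, 0 ≤ w i)
    (S : Fin (n + 1) → EReal)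
    (hmono : Monotone S)
    (hreal : ∀ i : Fin (n + 1), i ≠ Fin.last n → ∃ r : ℝ, S i = (r : EReal))
    (hlast : S (Fin.last n) = ⊤)
    (γ : ℝ) (hγ : γ ∈ Set.Icc (0 : ℝ) 1)
    (I : Finset (Fin (n + 1))) (hI : Fin.last n ∉ I)
    (hpos : 0 < ∑ k ∈ I, w k)
    (p : Fin (n + 1) → ℝ → ℝ)
    (hp : ∀ i ω, p i ω =
      (if i = Fin.last n then ω else w i) / (∑ k ∈ I, w k + ω))
    (Q : ℝ → EReal)
    (hQ : ∀ ω, Q ω = sInf {t : EReal |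
      ∃ i ∈ insert (Fin.last n) I,
        (γ ≤ ∑ k ∈ (insert (Fin.last n) I).filter (fun k => k ≤ i), p k ω) ∧
        S i = t})
    (ω₁ ω₂ : ℝ) (h21 : ω₂ ≤ ω₁) (h2 : 0 ≤ ω₂) :
    Q ω₂ ≤ Q ω₁ := by
  rw [hQ, hQ]
  refine sInf_le_sInf ?_
  rintro t ⟨i, hi, hγi, rfl⟩
  refine ⟨i, hi, ?_, rfl⟩
  have hW₂ : 0 < ∑ k ∈ I, w k + ω₂ := by linarith
  have hsum : ∑ k ∈ I, p k ω₂ = (∑ k ∈ I, w k) / (∑ k ∈ I, w k + ω₂) := by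
    rw [Finset.sum_div]
    refine Finset.sum_congr rfl fun k hk => ?_
    rw [hp, if_neg (ne_of_mem_of_not_mem hk hI)]
  by_cases hil : i = Fin.last n
  · have htotal : ∑ k ∈ insert (Fin.last n) I with k ≤ i, p k ω₂ = 1 := by
      rw [Finset.filter_true_of_mem fun k _ => hil ▸ Fin.le_last k, Finset.sum_insert hI, hp,
        if_pos rfl, hsum, ← add_div, add_comm, div_self hW₂.ne']
    exact htotal ▸ hγ.2
  · refine hγi.trans (Finset.sum_le_sum fun k hk => ?_)
    have hkl : k ≠ Fin.last n := fun h =>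
      hil (Fin.last_le_iff.mp (h ▸ (Finset.mem_filter.mp hk).2))
    rw [hp, hp, if_neg hkl, if_neg hkl]
    exact div_le_div_of_nonneg_left (hw k) hW₂ (add_le_add_right h21 _)
end

section
/- Let W_1,…,W_{n+1} be exchangeable real-valued random variables (their joint law is invariant under every permutation of the indices) and let β ∈ (0,1). Define the inflated empirical quantile W̃ = Quantile(1−β; ∑_{i=1}^n (n+1)^{-1} δ_{W_i} + (n+1)^{-1} δ_{+∞}). Then P(W_{n+1} ≤ W̃) ≥ 1 − β. -/
/-
STATEMENT 7: for exchangeable real random variables `W_1, …, W_{n+1}` and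
`β ∈ (0,1)`, the inflated empirical quantile
`W̃ = Quantile(1−β; ∑_{i≤n} (n+1)⁻¹ δ_{W_i} + (n+1)⁻¹ δ_{+∞})`
satisfies `P(W_{n+1} ≤ W̃) ≥ 1 − β`.
-/

open MeasureTheory Finset
open scoped Classical ENNReal

/-- `wQuantile γ A p s` is the `γ`-quantile
`inf { t : ∑_{i ∈ A, s i ≤ t} p i ≥ γ }` of the discrete distribution placing
weight `p i` on the atom `s i`, for `i ∈ A`. -/
noncomputable def wQuantile {ι T : Type*} [CompleteLinearOrder T]
    (γ : ℝ) (A : Finset ι) (p : ι → ℝ) (s : ι → T) : T :=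
  sInf {t : T | γ ≤ ∑ i ∈ A, if s i ≤ t then p i else 0}

/-- Among finitely many reals, at least `c` of them have fewer than `c` strict predecessors. -/
lemma le_card_filter_card_lt {ι : Type*} [Fintype ι] (w : ι → ℝ) {c : ℝ}
    (hc : c ≤ Fintype.card ι) :
    c ≤ #{j | (#{i | w i < w j} : ℝ) < c} := by
  rcases (univ.filter fun j => ¬ (#{i | w i < w j} : ℝ) < c).eq_empty_or_nonempty with h | h
  · rw [filter_eq_empty_iff] at h
    rw [filter_true_of_mem fun j hj => not_not.mp (h hj)]
    simpa using hc
  · obtain ⟨j, hj, hmin⟩ := exists_min_image _ w h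
    have hcj : c ≤ #{i | w i < w j} := not_lt.mp (mem_filter.mp hj).2
    refine hcj.trans (Nat.cast_le.mpr (card_le_card fun i hi => ?_))
    simp only [mem_filter, mem_univ, true_and] at hi ⊢
    by_contra hic
    exact (hmin i (by simpa using hic)).not_gt hi

lemma measurableSet_card_filter_lt {ι : Type*} [Fintype ι] (j : ι) (c : ℝ) :
    MeasurableSet {w : ι → ℝ | (#{i | w i < w j} : ℝ) < c} := by
  refine measurableSet_lt ?_ measurable_const
  simp only [card_filter, Nat.cast_sum, Nat.cast_ite, Nat.cast_one, Nat.cast_zero]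
  refine Finset.measurable_sum _ fun i _ => Measurable.ite ?_ measurable_const measurable_const
  exact measurableSet_lt (measurable_pi_apply i) (measurable_pi_apply j)

lemma card_filter_comp_perm_lt {ι : Type*} [Fintype ι] (w : ι → ℝ) (σ : Equiv.Perm ι) (x : ℝ) :
    #{i | w (σ i) < x} = #{i | w i < x} := by
  simp only [card_filter]
  exact Equiv.sum_comp σ fun i => if w i < x then 1 else 0

/-- For an exchangeable family, the rank of any coordinate has the same law. -/
lemma measure_card_filter_lt_eq {Ω ι : Type*} [MeasurableSpace Ω] [Fintype ι] {μ : Measure Ω}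
    {W : ι → Ω → ℝ} (hW : ∀ i, Measurable (W i))
    (hexch : ∀ σ : Equiv.Perm ι,
      μ.map (fun ω => fun i => W (σ i) ω) = μ.map (fun ω => fun i => W i ω))
    (c : ℝ) (j k : ι) :
    μ {ω | (#{i | W i ω < W j ω} : ℝ) < c} = μ {ω | (#{i | W i ω < W k ω} : ℝ) < c} := by
  have h := congrArg (fun ν => ν {w : ι → ℝ | (#{i | w i < w k} : ℝ) < c})
    (hexch (Equiv.swap k j))
  rw [Measure.map_apply (measurable_pi_lambda _ fun i => hW _) (measurableSet_card_filter_lt k c),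
    Measure.map_apply (measurable_pi_lambda _ hW) (measurableSet_card_filter_lt k c)] at h
  simp only [Set.preimage_ofPred_eq, Equiv.swap_apply_left] at h
  rw [← h]
  congr 1
  ext ω
  simp only [Set.mem_ofPred_eq]
  rw [card_filter_comp_perm_lt (fun i => W i ω)]

/-- If `c` is at most the size of an exchangeable family, a given coordinate has fewer than `c`
strict predecessors with probability at least `c` divided by that size. -/
lemma ofReal_div_le_measure_card_filter_lt {Ω ι : Type*} [MeasurableSpace Ω] [Fintype ι]
    {μ : Measure Ω} [IsProbabilityMeasure μ] {W : ι → Ω → ℝ} (hW : ∀ i, Measurable (W i))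
    (hexch : ∀ σ : Equiv.Perm ι,
      μ.map (fun ω => fun i => W (σ i) ω) = μ.map (fun ω => fun i => W i ω))
    {c : ℝ} (hc : c ≤ Fintype.card ι) (k : ι) :
    ENNReal.ofReal c / Fintype.card ι ≤ μ {ω | (#{i | W i ω < W k ω} : ℝ) < c} := by
  have hmeas : ∀ j, MeasurableSet {ω | (#{i | W i ω < W j ω} : ℝ) < c} := fun j =>
    measurable_pi_lambda (fun ω i => W i ω) hW (measurableSet_card_filter_lt j c)
  refine ENNReal.div_le_of_le_mul' ?_
  calc ENNReal.ofReal c = ∫⁻ _, ENNReal.ofReal c ∂μ := by simp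
    _ ≤ ∫⁻ ω, ∑ j, {ω | (#{i | W i ω < W j ω} : ℝ) < c}.indicator 1 ω ∂μ := by
        refine lintegral_mono fun ω => ?_
        have h := ENNReal.ofReal_le_ofReal (le_card_filter_card_lt (fun i => W i ω) hc)
        rw [ENNReal.ofReal_natCast, card_filter] at h
        simpa [Set.indicator_apply] using h
    _ = ∑ j, μ {ω | (#{i | W i ω < W j ω} : ℝ) < c} := by
        rw [lintegral_finsetSum _ fun j _ => measurable_one.indicator (hmeas j)]
        exact sum_congr rfl fun j _ => lintegral_indicator_one (hmeas j)
    _ = Fintype.card ι * μ {ω | (#{i | W i ω < W k ω} : ℝ) < c} := by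
        rw [sum_congr rfl fun j _ => measure_card_filter_lt_eq hW hexch c j k]
        simp

/-- A value with fewer than `γ (n + 1)` strict predecessors is at most the inflated quantile. -/
lemma coe_le_wQuantile_of_card_lt {n : ℕ} (w : Fin (n + 1) → ℝ) {γ : ℝ}
    (h : (#{i | w i < w (Fin.last n)} : ℝ) < γ * (n + 1)) :
    ((w (Fin.last n) : ℝ) : EReal) ≤
      wQuantile γ (Finset.univ : Finset (Option (Fin n))) (fun _ => 1 / ((n : ℝ) + 1))
        (fun o => o.elim (⊤ : EReal) (fun i => ((w i.castSucc : ℝ) : EReal))) := by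
  refine le_sInf fun t ht => ?_
  by_contra! hlt
  have htop : ¬ (⊤ : EReal) ≤ t := fun hle => (hle.trans_lt hlt).not_ge le_top
  have hn : (0 : ℝ) < n + 1 := by positivity
  rw [Set.mem_ofPred_eq, Fintype.sum_option, if_neg (by exact htop), zero_add] at ht
  replace ht : γ ≤ ∑ i : Fin n, if ((w i.castSucc : ℝ) : EReal) ≤ t then 1 / ((n : ℝ) + 1) else 0 :=
    ht
  rw [← sum_filter, sum_const, nsmul_eq_mul, mul_one_div, le_div_iff₀ hn] at ht
  refine (ht.trans (Nat.cast_le.mpr ?_)).not_gt h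
  refine card_le_card_of_injOn Fin.castSucc (fun i hi => ?_) (Fin.castSucc_injective n).injOn
  simp only [coe_filter, mem_univ, true_and, Set.mem_ofPred_eq] at hi ⊢
  exact EReal.coe_lt_coe_iff.mp (hi.trans_lt hlt)

theorem exchangeable_inflated_quantile_coverage
    {Ω : Type*} [MeasurableSpace Ω] (μ : Measure Ω) [IsProbabilityMeasure μ]
    (n : ℕ) (W : Fin (n + 1) → Ω → ℝ) (hW : ∀ i, Measurable (W i))
    (hexch : ∀ σ : Equiv.Perm (Fin (n + 1)),
      μ.map (fun ω => fun i => W (σ i) ω) = μ.map (fun ω => fun i => W i ω))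
    (β : ℝ) (hβ : β ∈ Set.Ioo (0 : ℝ) 1) :
    ENNReal.ofReal (1 - β) ≤
      μ {ω | ((W (Fin.last n) ω : ℝ) : EReal) ≤
        wQuantile (1 - β) (Finset.univ : Finset (Option (Fin n)))
          (fun _ => 1 / ((n : ℝ) + 1))
          (fun o => o.elim (⊤ : EReal) (fun i => ((W i.castSucc ω : ℝ) : EReal)))} := by
  have hn : (0 : ℝ) < n + 1 := by positivity
  have hc : (1 - β) * (n + 1) ≤ Fintype.card (Fin (n + 1)) := by
    rw [Fintype.card_fin]
    push_cast
    nlinarith [hβ.1]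
  have key := ofReal_div_le_measure_card_filter_lt hW hexch hc (Fin.last n)
  have hdiv : ENNReal.ofReal ((1 - β) * (n + 1)) / Fintype.card (Fin (n + 1)) =
      ENNReal.ofReal (1 - β) := by
    rw [← ENNReal.ofReal_natCast, Fintype.card_fin, Nat.cast_add_one,
      ← ENNReal.ofReal_div_of_pos hn, mul_div_cancel_right₀ _ hn.ne']
  rw [hdiv] at key
  exact key.trans (measure_mono fun ω hω => coe_le_wQuantile_of_card_lt (fun i => W i ω) hω)
end
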